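/- arXiv:math/0407530 — 2 statements merged into one kernel-verified Lean document; each statement's English description precedes it below -/
import Mathlib

section
/- Let (ε_1, …, ε_n) be an orthonormal basis of V, let μ_1, …, μ_n be real numbers, and let L = Σ_{i=1}^n μ_i ℓ(ε_i) r(ε_i) as an endomorphism of Λ•V. Then L is diagonal in the monomial basis: for every strictly increasing multi-index I = (i_1 < ⋯ < i_p), L(ε_{i_1} ∧ ⋯ ∧ ε_{i_p}) = (−1)^p (Σ_{k ∈ I} μ_k − Σ_{k ∉ I} μ_k) · ε_{i_1} ∧ ⋯ ∧ ε_{i_p}. -/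
open ExteriorAlgebra

variable {V : Type*} [NormedAddCommGroup V] [InnerProductSpace ℝ V] [FiniteDimensional ℝ V]

/-- The interior product `ι_v` on the exterior algebra of a real inner product space:
the unique antiderivation extending `w ↦ ⟪v, w⟫`. -/
noncomputable def interiorProduct (v : V) : Module.End ℝ (ExteriorAlgebra ℝ V) :=
  CliffordAlgebra.contractLeft (Q := (0 : QuadraticForm ℝ V)) (innerₗ V v)

/-- The left Clifford action `ℓ(v) ω = v ∧ ω − ι_v ω`. -/
noncomputable def leftAction (v : V) : Module.End ℝ (ExteriorAlgebra ℝ V) :=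
  LinearMap.mulLeft ℝ (ι ℝ v) - interiorProduct v

/-- The right Clifford action, `r(v) ω = (−1)^p (v ∧ ω + ι_v ω)` on `p`-forms.
(`CliffordAlgebra.involute` is multiplication by `(−1)^p` on `p`-forms.) -/
noncomputable def rightAction (v : V) : Module.End ℝ (ExteriorAlgebra ℝ V) :=
  (LinearMap.mulLeft ℝ (ι ℝ v) + interiorProduct v) ∘ₗ
    (CliffordAlgebra.involute (Q := (0 : QuadraticForm ℝ V))).toLinearMap

/-- The monomial `ε_{i₁} ∧ ⋯ ∧ ε_{i_p}` associated with a family `ε` and a finite set of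
indices `s = {i₁ < ⋯ < i_p}` (taken in increasing order; `s = ∅` gives `1`). -/
noncomputable def monomial {n : ℕ} (ε : Fin n → V) (s : Finset (Fin n)) :
    ExteriorAlgebra ℝ V :=
  ((s.sort (· ≤ ·)).map (fun i => ι ℝ (ε i))).prod

/-- `B` is the inner product on `Λ•V` induced by the inner product of `V`: it is the
symmetric bilinear form for which, given any orthonormal basis `(ε i)` of `V`, the
monomials `ε_{i₁} ∧ ⋯ ∧ ε_{i_p}` with `i₁ < ⋯ < i_p` (together with `1`) form an
orthonormal basis. -/
def IsInducedInner (B : LinearMap.BilinForm ℝ (ExteriorAlgebra ℝ V)) : Prop :=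
  (∀ ω η, B ω η = B η ω) ∧
  ∀ (ε : OrthonormalBasis (Fin (Module.finrank ℝ V)) ℝ V)
    (s t : Finset (Fin (Module.finrank ℝ V))),
    B (monomial (⇑ε) s) (monomial (⇑ε) t) = if s = t then 1 else 0

theorem interiorProduct_ι_mul {W : Type*} [NormedAddCommGroup W] [InnerProductSpace ℝ W]
    (v w : W) (ω : ExteriorAlgebra ℝ W) :
    interiorProduct v (ι ℝ w * ω)
      = inner ℝ v w • ω - ι ℝ w * interiorProduct v ω :=
  CliffordAlgebra.contractLeft_ι_mul (Q := (0 : QuadraticForm ℝ W)) (d := innerₗ W v) w ω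

theorem interiorProduct_interiorProduct {W : Type*} [NormedAddCommGroup W] [InnerProductSpace ℝ W]
    (v : W) (ω : ExteriorAlgebra ℝ W) :
    interiorProduct v (interiorProduct v ω) = 0 :=
  CliffordAlgebra.contractLeft_contractLeft (Q := (0 : QuadraticForm ℝ W)) (d := innerₗ W v) ω

theorem leftAction_rightAction_apply {W : Type*} [NormedAddCommGroup W] [InnerProductSpace ℝ W]
    (v : W) (ω : ExteriorAlgebra ℝ W) :
    leftAction v (rightAction v ω)
      = (2 : ℝ) • (ι ℝ v * interiorProduct v
          (CliffordAlgebra.involute (Q := (0 : QuadraticForm ℝ W)) ω))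
        - inner ℝ v v • CliffordAlgebra.involute (Q := (0 : QuadraticForm ℝ W)) ω := by
  simp only [leftAction, rightAction, LinearMap.comp_apply, LinearMap.add_apply,
    LinearMap.sub_apply, LinearMap.mulLeft_apply, AlgHom.toLinearMap_apply, map_add]
  rw [interiorProduct_interiorProduct, interiorProduct_ι_mul, ← mul_assoc,
    ι_sq_zero, zero_mul, two_smul]
  abel

theorem interiorProduct_prod_of_notMem {W : Type*} [NormedAddCommGroup W] [InnerProductSpace ℝ W]
    {κ : Type*} {ε : κ → W} (hε : Orthonormal ℝ ε) (k : κ)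
    (l : List κ) (hk : k ∉ l) :
    interiorProduct (ε k) (l.map fun i => ι ℝ (ε i)).prod = 0 := by
  induction l with
  | nil => exact CliffordAlgebra.contractLeft_one (Q := (0 : QuadraticForm ℝ W)) _
  | cons a t ih =>
    rw [List.mem_cons, not_or] at hk
    rw [List.map_cons, List.prod_cons, interiorProduct_ι_mul, hε.2 hk.1, ih hk.2]
    simp

theorem ι_mul_interiorProduct_prod_of_mem {W : Type*} [NormedAddCommGroup W] [InnerProductSpace ℝ W]
    {κ : Type*} {ε : κ → W} (hε : Orthonormal ℝ ε) (k : κ)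
    (l : List κ) (hl : l.Nodup) (hk : k ∈ l) :
    ι ℝ (ε k) * interiorProduct (ε k) (l.map fun i => ι ℝ (ε i)).prod
      = (l.map fun i => ι ℝ (ε i)).prod := by
  induction l with
  | nil => simp at hk
  | cons a t ih =>
    rw [List.nodup_cons] at hl
    rw [List.map_cons, List.prod_cons, interiorProduct_ι_mul]
    by_cases h : k = a
    · subst h
      rw [interiorProduct_prod_of_notMem hε k t hl.1, real_inner_self_eq_norm_sq, hε.1 k]
      simp
    · have hkt : k ∈ t := (List.mem_cons.mp hk).resolve_left h
      rw [hε.2 h, zero_smul, zero_sub, mul_neg, ← mul_assoc,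
        eq_neg_of_add_eq_zero_left (ι_add_mul_swap (R := ℝ) (ε k) (ε a)), neg_mul, neg_neg,
        mul_assoc, ih hl.2 hkt]

theorem involute_monomial {W : Type*} [NormedAddCommGroup W] [InnerProductSpace ℝ W]
    {n : ℕ} (ε : Fin n → W) (s : Finset (Fin n)) :
    CliffordAlgebra.involute (Q := (0 : QuadraticForm ℝ W)) (monomial ε s)
      = (-1 : ℝ) ^ s.card • monomial ε s := by
  have h := CliffordAlgebra.involute_prod_map_ι (Q := (0 : QuadraticForm ℝ W))
    ((s.sort (· ≤ ·)).map ε)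
  rw [List.map_map, List.length_map, Finset.length_sort] at h
  exact h

theorem leftAction_rightAction_monomial {W : Type*} [NormedAddCommGroup W] [InnerProductSpace ℝ W]
    {n : ℕ} {ε : Fin n → W} (hε : Orthonormal ℝ ε)
    (k : Fin n) (s : Finset (Fin n)) :
    leftAction (ε k) (rightAction (ε k) (monomial ε s))
      = ((-1 : ℝ) ^ s.card * if k ∈ s then 1 else -1) • monomial ε s := by
  rw [leftAction_rightAction_apply, involute_monomial, map_smul, mul_smul_comm,
    real_inner_self_eq_norm_sq, hε.1 k]
  split_ifs with hk
  · have h : ι ℝ (ε k) * interiorProduct (ε k) (monomial ε s) = monomial ε s :=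
      ι_mul_interiorProduct_prod_of_mem hε k _ (s.sort_nodup _) (by simpa using hk)
    rw [h]
    module
  · have h : interiorProduct (ε k) (monomial ε s) = 0 :=
      interiorProduct_prod_of_notMem hε k _ (by simpa using hk)
    rw [h, mul_zero]
    module

/-- Let `(ε i)` be an orthonormal basis of `V`, let `μ i` be real
numbers, and let `L = Σ_i μ_i ℓ(ε_i) r(ε_i)` as an endomorphism of `Λ•V`. Then `L` is
diagonal in the monomial basis: for every strictly increasing multi-index
`s = {i₁ < ⋯ < i_p}`,
`L (ε_{i₁} ∧ ⋯ ∧ ε_{i_p}) = (−1)^p (Σ_{k ∈ s} μ k − Σ_{k ∉ s} μ k) • ε_{i₁} ∧ ⋯ ∧ ε_{i_p}`. -/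
theorem sum_leftAction_rightAction_diagonal
    {n : ℕ} (ε : OrthonormalBasis (Fin n) ℝ V) (μ : Fin n → ℝ)
    (L : Module.End ℝ (ExteriorAlgebra ℝ V))
    (hL : L = ∑ i, μ i • (leftAction (ε i) * rightAction (ε i)))
    (s : Finset (Fin n)) :
    L (monomial (⇑ε) s)
      = ((-1 : ℝ) ^ s.card * ((∑ k ∈ s, μ k) - ∑ k ∈ sᶜ, μ k)) • monomial (⇑ε) s := by
  have key : ∑ i, μ i * ((-1 : ℝ) ^ s.card * if i ∈ s then 1 else -1)
      = (-1 : ℝ) ^ s.card * ((∑ k ∈ s, μ k) - ∑ k ∈ sᶜ, μ k) := by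
    rw [← Finset.sum_add_sum_compl s, mul_sub, Finset.mul_sum, Finset.mul_sum, sub_eq_add_neg,
      ← Finset.sum_neg_distrib]
    congr 1
    · refine Finset.sum_congr rfl fun i hi => ?_
      rw [if_pos hi]
      ring
    · refine Finset.sum_congr rfl fun i hi => ?_
      rw [if_neg (Finset.mem_compl.mp hi)]
      ring
  rw [hL, LinearMap.sum_apply, ← key, Finset.sum_smul]
  refine Finset.sum_congr rfl fun i _ => ?_
  rw [LinearMap.smul_apply, Module.End.mul_apply,
    leftAction_rightAction_monomial ε.orthonormal, smul_smul]
end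

section
/- Let A and B be bounded operators on a complex Hilbert space H, with A self-adjoint, and set c = ‖A − B‖ (the operator norm of A − B). If the spectrum of A contains no point of the open interval (−c, c), then for every ψ in the kernel of B one has ‖Aψ‖ = c‖ψ‖ and ‖(A − B)ψ‖ = c‖ψ‖. -/
open ContinuousLinearMap in
/-- If the real spectrum of a self-adjoint operator `A` avoids `(-c, c)`, then `A` is bounded
below by `c`. -/
theorem IsSelfAdjoint.mul_norm_le_norm_apply_of_spectrum
    {H : Type*} [NormedAddCommGroup H] [InnerProductSpace ℂ H] [CompleteSpace H]
    {A : H →L[ℂ] H} (hA : IsSelfAdjoint A) {c : ℝ}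
    (hgap : ∀ t ∈ spectrum ℝ A, t ∉ Set.Ioo (-c) c) (ψ : H) :
    c * ‖ψ‖ ≤ ‖A ψ‖ := by
  obtain hc | hc := le_total c 0
  · exact (mul_nonpos_of_nonpos_of_nonneg hc (norm_nonneg ψ)).trans (norm_nonneg _)
  have hle : algebraMap ℝ (H →L[ℂ] H) (c ^ 2) ≤ A ^ 2 := by
    rw [← cfc_pow_id (R := ℝ) A 2 hA]
    refine algebraMap_le_cfc _ _ _ (fun t ht ↦ ?_) (by fun_prop) hA
    refine sq_le_sq.2 ?_
    rw [abs_of_nonneg hc]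
    by_contra! h
    exact hgap t ht (abs_lt.1 h)
  have hpos := ((ContinuousLinearMap.le_def _ _).1 hle).re_inner_nonneg_left ψ
  have hsq : inner ℂ ((A ^ 2) ψ) ψ = inner ℂ (A ψ) (A ψ) := by
    rw [pow_two, mul_apply_eq_comp, ← adjoint_inner_right, hA.adjoint_eq]
  have hcc : inner ℂ (algebraMap ℝ (H →L[ℂ] H) (c ^ 2) ψ) ψ = (c ^ 2 : ℝ) * inner ℂ ψ ψ := by
    rw [Algebra.algebraMap_eq_smul_one, _root_.smul_apply,
      one_apply_eq_self, inner_smul_left_eq_smul, Complex.real_smul]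
  rw [sub_apply, inner_sub_left, hsq, hcc, map_sub, inner_self_eq_norm_sq, RCLike.re_to_complex,
    Complex.re_ofReal_mul, ← RCLike.re_to_complex, inner_self_eq_norm_sq] at hpos
  refine (sq_le_sq₀ (by positivity) (norm_nonneg _)).1 ?_
  rw [mul_pow]
  linarith

/-- Let `A` and `B` be bounded operators on a complex Hilbert space
`H`, with `A` self-adjoint, and set `c = ‖A − B‖`. If the spectrum of `A` contains no
point of the open interval `(−c, c)`, then for every `ψ` in the kernel of `B` one has
`‖A ψ‖ = c ‖ψ‖` and `‖(A − B) ψ‖ = c ‖ψ‖`. -/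
theorem norm_eq_of_no_spectrum_in_open_gap
    {H : Type*} [NormedAddCommGroup H] [InnerProductSpace ℂ H] [CompleteSpace H]
    (A B : H →L[ℂ] H) (hA : IsSelfAdjoint A)
    (c : ℝ) (hc : c = ‖A - B‖)
    (hgap : ∀ t : ℝ, t ∈ Set.Ioo (-c) c → (t : ℂ) ∉ spectrum ℂ A) :
    ∀ ψ : H, B ψ = 0 → ‖A ψ‖ = c * ‖ψ‖ ∧ ‖(A - B) ψ‖ = c * ‖ψ‖ := by
  intro ψ hψ
  have heq : (A - B) ψ = A ψ := by simp [hψ]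
  have hlower : c * ‖ψ‖ ≤ ‖A ψ‖ :=
    hA.mul_norm_le_norm_apply_of_spectrum
      (fun t ht htc ↦ hgap t htc ((spectrum.algebraMap_mem_iff ℂ).2 ht)) ψ
  have hupper : ‖A ψ‖ ≤ c * ‖ψ‖ := by
    rw [← heq, hc]
    exact (A - B).le_opNorm ψ
  rw [heq]
  exact ⟨hupper.antisymm hlower, hupper.antisymm hlower⟩
end
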